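/- arXiv:2010.00260 — 4 statements merged into one kernel-verified Lean document; each statement's English description precedes it below -/
import Mathlib

section
/- Let E(x) = ∫_0^x e^{-u²/2} du, and fix T > 0. For every t ∈ [0,T) and every y > 0, the quantity X = e^{-y²/(2(T−t))} / ( √(T−t) · E( y/√(T−t) ) ) − 1/y satisfies |X| ≤ (1/y) · min( 1 , y²/(2(T−t)) ) ≤ max( 1 , 1/(2(T−t)) ). -/
/-- `E(x) = ∫_0^x e^{-u²/2} du`. -/
noncomputable def gaussInt (x : ℝ) : ℝ := ∫ u in (0 : ℝ)..x, Real.exp (-u ^ 2 / 2)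

theorem intervalIntegrable_exp_neg_sq_div_two (a b : ℝ) :
    IntervalIntegrable (fun u : ℝ => Real.exp (-u ^ 2 / 2)) MeasureTheory.volume a b :=
  Continuous.intervalIntegrable (by fun_prop) a b

theorem mul_exp_le_gaussInt {x : ℝ} (hx : 0 ≤ x) :
    x * Real.exp (-x ^ 2 / 2) ≤ gaussInt x := by
  have h := intervalIntegral.integral_mono_on hx intervalIntegrable_const
    (intervalIntegrable_exp_neg_sq_div_two 0 x)
    (f := fun _ => Real.exp (-x ^ 2 / 2)) (fun u hu => by
      have : u ^ 2 ≤ x ^ 2 := pow_le_pow_left₀ hu.1 hu.2 2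
      exact Real.exp_le_exp.2 (by linarith))
  simpa [gaussInt] using h

theorem gaussInt_le_self {x : ℝ} (hx : 0 ≤ x) : gaussInt x ≤ x := by
  have h := intervalIntegral.integral_mono_on hx
    (intervalIntegrable_exp_neg_sq_div_two 0 x) intervalIntegrable_const
    (g := fun _ => (1 : ℝ)) (fun u _ => Real.exp_le_one_iff.2 (by nlinarith [sq_nonneg u]))
  simpa [gaussInt] using h

theorem gaussInt_pos {x : ℝ} (hx : 0 < x) : 0 < gaussInt x :=
  (mul_pos hx (Real.exp_pos _)).trans_le (mul_exp_le_gaussInt hx.le)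

theorem abs_mul_exp_div_gaussInt_sub_one_le {x : ℝ} (hx : 0 < x) :
    |x * Real.exp (-x ^ 2 / 2) / gaussInt x - 1| ≤ min 1 (x ^ 2 / 2) := by
  have hE := gaussInt_pos hx
  have hle : x * Real.exp (-x ^ 2 / 2) / gaussInt x ≤ 1 :=
    (div_le_one hE).2 (mul_exp_le_gaussInt hx.le)
  have hpos : 0 < x * Real.exp (-x ^ 2 / 2) / gaussInt x := by positivity
  rw [abs_of_nonpos (by linarith)]
  refine le_min (by linarith) ?_
  rcases le_total 1 (x ^ 2 / 2) with h | h
  · linarith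
  · have hexp := Real.add_one_le_exp (-x ^ 2 / 2)
    have hmul : (1 - x ^ 2 / 2) * gaussInt x ≤ x * Real.exp (-x ^ 2 / 2) := by
      calc (1 - x ^ 2 / 2) * gaussInt x ≤ (1 - x ^ 2 / 2) * x :=
            mul_le_mul_of_nonneg_left (gaussInt_le_self hx.le) (by linarith)
        _ ≤ Real.exp (-x ^ 2 / 2) * x := mul_le_mul_of_nonneg_right (by linarith) hx.le
        _ = x * Real.exp (-x ^ 2 / 2) := mul_comm _ _
    have := (le_div_iff₀ hE).2 hmul
    linarith

/-- For `T > 0`, `t ∈ [0,T)`, `y > 0`, the difference `X` between the meander drift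
`∂_y log γ_{ℝ₊}(T−t, y)` and the Bessel drift `1/y` satisfies
`|X| ≤ (1/y) min(1, y²/(2(T−t))) ≤ max(1, 1/(2(T−t)))`. -/
theorem meander_bessel_drift_difference_bound (T t y : ℝ) (hT : 0 < T)
    (ht0 : 0 ≤ t) (htT : t < T) (hy : 0 < y) :
    |Real.exp (-y ^ 2 / (2 * (T - t))) /
        (Real.sqrt (T - t) * gaussInt (y / Real.sqrt (T - t))) - 1 / y| ≤
      (1 / y) * min 1 (y ^ 2 / (2 * (T - t))) ∧
    (1 / y) * min 1 (y ^ 2 / (2 * (T - t))) ≤ max 1 (1 / (2 * (T - t))) := by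
  have hs : 0 < T - t := sub_pos.2 htT
  generalize T - t = s at hs ⊢
  have hr : 0 < Real.sqrt s := Real.sqrt_pos.2 hs
  have hx : 0 < y / Real.sqrt s := div_pos hy hr
  have hsq : (y / Real.sqrt s) ^ 2 / 2 = y ^ 2 / (2 * s) := by
    rw [div_pow, Real.sq_sqrt hs.le, div_div, mul_comm]
  constructor
  · have hE := gaussInt_pos hx
    have key := abs_mul_exp_div_gaussInt_sub_one_le hx
    rw [neg_div, hsq, ← neg_div] at key
    have heq : Real.exp (-y ^ 2 / (2 * s)) / (Real.sqrt s * gaussInt (y / Real.sqrt s)) - 1 / y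
        = 1 / y * (y / Real.sqrt s * Real.exp (-y ^ 2 / (2 * s)) /
          gaussInt (y / Real.sqrt s) - 1) := by
      generalize gaussInt (y / Real.sqrt s) = E at hE ⊢
      generalize Real.exp (-y ^ 2 / (2 * s)) = e
      field_simp
    rw [heq, abs_mul, abs_of_pos (one_div_pos.2 hy)]
    exact mul_le_mul_of_nonneg_left key (one_div_pos.2 hy).le
  · rcases le_total 1 y with h | h
    · refine le_max_of_le_left ?_
      exact mul_le_one₀ ((div_le_one hy).2 h) (by positivity) (min_le_left _ _)
    · refine le_max_of_le_right ?_
      calc 1 / y * min 1 (y ^ 2 / (2 * s)) ≤ 1 / y * (y ^ 2 / (2 * s)) :=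
            mul_le_mul_of_nonneg_left (min_le_right _ _) (one_div_pos.2 hy).le
        _ = y / (2 * s) := by field_simp
        _ ≤ 1 / (2 * s) := by gcongr
end

section
/- Fix T > 0 and t ∈ (0,T), and let γ(s,y) = √(2/π) ∫_0^{y/√s} e^{-z²/2} dz for s,y > 0. Then, as ε → 0+, the ratio ( ∫_0^∞ y γ(T−t,y) (2πt)^{-1/2} e^{-(y−ε)²/(2t)} (1 − e^{-2yε/t}) dy ) / ( ∫_0^∞ (2πT)^{-1/2} e^{-(y−ε)²/(2T)} (1 − e^{-2yε/T}) dy ) converges to √T · ∫_0^∞ y² γ(T−t, √t·y) e^{-y²/2} dy. -/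
open Filter Topology MeasureTheory

/-- `γ(s,y) = √(2/π) ∫_0^{y/√s} e^{-z²/2} dz`. -/
noncomputable def gammaPos (s y : ℝ) : ℝ :=
  Real.sqrt (2 / Real.pi) * ∫ z in (0 : ℝ)..(y / Real.sqrt s), Real.exp (-z ^ 2 / 2)

/-- The rate at which a Gaussian integral weighted by the survival probability of a Brownian
bridge vanishes as the starting point tends to `0`. -/
theorem tendsto_inv_mul_integral_gaussian_survival {s C : ℝ} (hs : 0 < s) {f : ℝ → ℝ}
    (hf : Continuous f) (hC : ∀ y, 0 < y → |f y| ≤ C * (1 + y ^ 2)) :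
    Tendsto
      (fun ε : ℝ => ε⁻¹ * ∫ y in Set.Ioi (0 : ℝ),
        f y * (Real.exp (-(y - ε) ^ 2 / (2 * s)) * (1 - Real.exp (-(2 * y * ε) / s))))
      (𝓝[>] 0)
      (𝓝 (∫ y in Set.Ioi (0 : ℝ), f y * (Real.exp (-y ^ 2 / (2 * s)) * (2 * y / s)))) := by
  have hb : 0 < 1 / (4 * s) := by positivity
  have hint1 : IntegrableOn (fun y : ℝ => y * Real.exp (-(1 / (4 * s)) * y ^ 2)) (Set.Ioi 0) :=
    (integrable_mul_exp_neg_mul_sq hb).integrableOn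
  have hint3 : IntegrableOn (fun y : ℝ => y ^ 3 * Real.exp (-(1 / (4 * s)) * y ^ 2))
      (Set.Ioi 0) := by
    have := (integrable_rpow_mul_exp_neg_mul_sq hb (s := 3) (by norm_num)).integrableOn
      (s := Set.Ioi 0)
    exact_mod_cast this
  simp_rw [← integral_const_mul]
  refine tendsto_integral_filter_of_dominated_convergence
    (fun y => C * Real.exp (1 / (2 * s)) * (2 / s) *
      (y * Real.exp (-(1 / (4 * s)) * y ^ 2) + y ^ 3 * Real.exp (-(1 / (4 * s)) * y ^ 2)))
    ?_ ?_ ((hint1.add hint3).const_mul _) ?_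
  · refine Eventually.of_forall fun ε => Continuous.aestronglyMeasurable ?_
    fun_prop
  · have h1 : ∀ᶠ ε in 𝓝[>] (0 : ℝ), ε ∈ Set.Ioo (0 : ℝ) 1 :=
      Ioo_mem_nhdsGT one_pos
    filter_upwards [h1] with ε hε
    refine (ae_restrict_mem measurableSet_Ioi).mono fun y hy => ?_
    have hy : 0 < y := hy
    have hε0 : 0 < ε := hε.1
    have hexp : Real.exp (-(y - ε) ^ 2 / (2 * s)) ≤
        Real.exp (1 / (2 * s)) * Real.exp (-(1 / (4 * s)) * y ^ 2) := by
      rw [← Real.exp_add, Real.exp_le_exp]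
      have : 1 / (2 * s) + -(1 / (4 * s)) * y ^ 2 = (1 - y ^ 2 / 2) / (2 * s) := by
        field_simp
        ring
      rw [this]
      gcongr
      nlinarith [sq_nonneg (y - 2 * ε), hε.2]
    have hu0 : 0 ≤ 1 - Real.exp (-(2 * y * ε) / s) := by
      rw [sub_nonneg, Real.exp_le_one_iff]
      exact div_nonpos_of_nonpos_of_nonneg (by nlinarith [mul_pos hy hε0]) hs.le
    have hu1 : 1 - Real.exp (-(2 * y * ε) / s) ≤ 2 * y / s * ε := by
      have h := Real.add_one_le_exp (-(2 * y * ε) / s)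
      have : -(2 * y * ε) / s = -(2 * y / s * ε) := by ring
      linarith
    have hC0 : 0 ≤ C * (1 + y ^ 2) := (abs_nonneg _).trans (hC y hy)
    rw [Real.norm_eq_abs, abs_mul, abs_mul, abs_mul, abs_of_pos (inv_pos.2 hε0),
      abs_of_pos (Real.exp_pos _), abs_of_nonneg hu0]
    calc ε⁻¹ * (|f y| * (Real.exp (-(y - ε) ^ 2 / (2 * s)) * (1 - Real.exp (-(2 * y * ε) / s))))
        ≤ ε⁻¹ * (C * (1 + y ^ 2) * (Real.exp (1 / (2 * s)) * Real.exp (-(1 / (4 * s)) * y ^ 2) *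
            (2 * y / s * ε))) := by
          gcongr
          exact hC y hy
      _ = _ := by
          field_simp
  · refine (ae_restrict_mem measurableSet_Ioi).mono fun y _ => ?_
    have hd : HasDerivAt (fun ε : ℝ => f y * (Real.exp (-(y - ε) ^ 2 / (2 * s)) *
        (1 - Real.exp (-(2 * y * ε) / s))))
        (f y * (Real.exp (-y ^ 2 / (2 * s)) * (2 * y / s))) 0 := by
      have ha : DifferentiableAt ℝ (fun ε : ℝ => Real.exp (-(y - ε) ^ 2 / (2 * s))) 0 := by
        fun_prop
      have hl : HasDerivAt (fun ε : ℝ => -(2 * y * ε) / s) (-(2 * y * 1) / s) 0 :=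
        (((hasDerivAt_id (0 : ℝ)).const_mul (2 * y)).neg).div_const s
      have h := (ha.hasDerivAt.mul (hl.exp.const_sub 1)).const_mul (f y)
      refine h.congr_deriv ?_
      simp
      ring_nf
    simpa using hd.tendsto_slope_zero_right

theorem continuous_gammaPos (s : ℝ) : Continuous (gammaPos s) := by
  have h : Continuous fun x : ℝ => ∫ z in (0 : ℝ)..x, Real.exp (-z ^ 2 / 2) :=
    intervalIntegral.continuous_primitive
      (fun a b => (by fun_prop : Continuous fun z : ℝ => Real.exp (-z ^ 2 / 2)).intervalIntegrable
        a b) 0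
  exact continuous_const.mul (h.comp (continuous_id.div_const _))

theorem abs_gammaPos_le (s : ℝ) {y : ℝ} (hy : 0 < y) :
    |gammaPos s y| ≤ Real.sqrt (2 / Real.pi) / Real.sqrt s * y := by
  have h : ‖∫ z in (0 : ℝ)..(y / Real.sqrt s), Real.exp (-z ^ 2 / 2)‖ ≤
      1 * |y / Real.sqrt s - 0| := by
    refine intervalIntegral.norm_integral_le_of_norm_le_const fun z _ => ?_
    rw [Real.norm_eq_abs, abs_of_pos (Real.exp_pos _), Real.exp_le_one_iff]
    nlinarith [sq_nonneg z]
  rw [sub_zero, one_mul, abs_of_nonneg (by positivity), Real.norm_eq_abs] at h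
  rw [gammaPos, abs_mul, abs_of_nonneg (Real.sqrt_nonneg _), div_mul_eq_mul_div, ← mul_div_assoc']
  gcongr

theorem integral_exp_neg_sq_div_mul_two_mul_div {s : ℝ} (hs : 0 < s) :
    ∫ y in Set.Ioi (0 : ℝ), Real.exp (-y ^ 2 / (2 * s)) * (2 * y / s) = 2 := by
  have h := integral_rpow_mul_exp_neg_mul_rpow (p := 2) (q := 1) (b := 1 / (2 * s))
    (by norm_num) (by norm_num) (by positivity)
  have h2 : ∫ y in Set.Ioi (0 : ℝ), y * Real.exp (-(1 / (2 * s)) * y ^ 2) = s := by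
    convert h using 1
    · simp
    · norm_num
      rw [Real.rpow_neg_one]
      field_simp
  have h3 : ∀ y : ℝ, Real.exp (-y ^ 2 / (2 * s)) * (2 * y / s) =
      2 / s * (y * Real.exp (-(1 / (2 * s)) * y ^ 2)) := fun y => by
    rw [show -y ^ 2 / (2 * s) = -(1 / (2 * s)) * y ^ 2 by ring]
    ring
  simp_rw [h3]
  rw [integral_const_mul, h2]
  field_simp

/-- As `ε → 0+`, the conditional expectation
`E[B_ε(t) | min_{s∈[0,T]} B_ε(s) > 0]`, written as a ratio of integrals, converges to
`√T ∫_0^∞ y² γ(T−t, √t y) e^{-y²/2} dy`. -/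
theorem conditional_expectation_limit (T t : ℝ) (hT : 0 < T) (ht0 : 0 < t) (htT : t < T) :
    Tendsto
      (fun ε : ℝ =>
        (∫ y in Set.Ioi (0 : ℝ),
            y * gammaPos (T - t) y * (1 / Real.sqrt (2 * Real.pi * t)) *
              Real.exp (-(y - ε) ^ 2 / (2 * t)) * (1 - Real.exp (-(2 * y * ε) / t))) /
          (∫ y in Set.Ioi (0 : ℝ),
            (1 / Real.sqrt (2 * Real.pi * T)) * Real.exp (-(y - ε) ^ 2 / (2 * T)) *
              (1 - Real.exp (-(2 * y * ε) / T))))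
      (𝓝[>] 0)
      (𝓝 (Real.sqrt T *
        ∫ y in Set.Ioi (0 : ℝ),
          y ^ 2 * gammaPos (T - t) (Real.sqrt t * y) * Real.exp (-y ^ 2 / 2))) := by
  have ht : 0 < Real.sqrt t := Real.sqrt_pos.2 ht0
  have hnum := tendsto_inv_mul_integral_gaussian_survival ht0
    (f := fun y => y * gammaPos (T - t) y)
    (C := Real.sqrt (2 / Real.pi) / Real.sqrt (T - t))
    (continuous_id.mul (continuous_gammaPos _)) (fun y hy => by
      rw [abs_mul, abs_of_pos hy]
      have hK : 0 ≤ Real.sqrt (2 / Real.pi) / Real.sqrt (T - t) := by positivity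
      nlinarith [mul_le_mul_of_nonneg_left (abs_gammaPos_le (T - t) hy) hy.le])
  have hden := tendsto_inv_mul_integral_gaussian_survival hT (f := fun _ => 1) (C := 1)
    continuous_const (fun y _ => by rw [abs_one]; nlinarith [sq_nonneg y])
  simp only [one_mul] at hden
  rw [integral_exp_neg_sq_div_mul_two_mul_div hT] at hden
  have hlim := ((hnum.const_mul (1 / Real.sqrt (2 * Real.pi * t))).div
    (hden.const_mul (1 / Real.sqrt (2 * Real.pi * T))) (by positivity))
  have hscale : ∫ y in Set.Ioi (0 : ℝ), y * gammaPos (T - t) y *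
      (Real.exp (-y ^ 2 / (2 * t)) * (2 * y / t)) =
      2 * Real.sqrt t * ∫ y in Set.Ioi (0 : ℝ),
          y ^ 2 * gammaPos (T - t) (Real.sqrt t * y) * Real.exp (-y ^ 2 / 2) := by
    have h := integral_comp_mul_left_Ioi (fun y => y * gammaPos (T - t) y *
      (Real.exp (-y ^ 2 / (2 * t)) * (2 * y / t))) 0 ht
    rw [mul_zero, smul_eq_mul, eq_inv_mul_iff_mul_eq₀ ht.ne'] at h
    rw [← h, mul_comm 2 (Real.sqrt t), mul_assoc, ← integral_const_mul 2]
    congr 2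
    ext y
    have hsq : Real.sqrt t ^ 2 = t := Real.sq_sqrt ht0.le
    rw [show -(Real.sqrt t * y) ^ 2 / (2 * t) = -y ^ 2 / 2 by
      rw [mul_pow, hsq]
      field_simp]
    have : Real.sqrt t * y * (2 * (Real.sqrt t * y) / t) = 2 * y ^ 2 := by
      rw [show Real.sqrt t * y * (2 * (Real.sqrt t * y) / t) =
        Real.sqrt t ^ 2 * (2 * y ^ 2) / t by ring, hsq]
      field_simp
    linear_combination (gammaPos (T - t) (Real.sqrt t * y) * Real.exp (-y ^ 2 / 2)) * this
  rw [hscale] at hlim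
  convert hlim.congr' ?_ using 2
  · rw [Real.sqrt_mul (by positivity) t, Real.sqrt_mul (by positivity) T]
    generalize (∫ y in Set.Ioi (0 : ℝ),
      y ^ 2 * gammaPos (T - t) (Real.sqrt t * y) * Real.exp (-y ^ 2 / 2)) = I
    field_simp
  · filter_upwards [self_mem_nhdsWithin] with ε hε
    have hε : (0 : ℝ) < ε := hε
    simp only [Pi.div_apply]
    rw [mul_left_comm, mul_left_comm _ ε⁻¹, mul_div_mul_left _ _ (inv_ne_zero hε.ne'),
      ← integral_const_mul, ← integral_const_mul]
    congr 2 <;> ext y <;> ring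
end

section
/- Fix T > 0 and 0 < δ < T. Then, as ε → 0+, the ratio ( ∫_0^∞ y^{-3/2} e^{-(y−ε)²/(2(T−δ))} (1 − e^{-2yε/δ}) dy ) / ( ∫_0^∞ e^{-(y−ε)²/(2T)} (1 − e^{-2yε/T}) dy ) converges to (T/δ) · ( ∫_0^∞ y^{-1/2} e^{-y²/(2(T−δ))} dy ) / ( ∫_0^∞ y e^{-y²/(2T)} dy ). -/
open Filter Topology MeasureTheory

/-- The slope at `0` of `ε ↦ 1 - exp (-(2 y ε) / c)` is `2 y / c`. -/
lemma tendsto_inv_mul_one_sub_exp (y c : ℝ) :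
    Tendsto (fun ε : ℝ => ε⁻¹ * (1 - Real.exp (-(2 * y * ε) / c))) (𝓝[>] 0)
      (𝓝 (2 / c * y)) := by
  have hd : HasDerivAt (fun ε : ℝ => 1 - Real.exp (-(2 * y * ε) / c)) (2 / c * y) 0 := by
    have h := ((((hasDerivAt_id (0 : ℝ)).const_mul (2 * y)).neg.div_const c).exp).const_sub 1
    convert! h using 1
    simp
    ring
  have h := (hasDerivAt_iff_tendsto_slope_zero.1 hd).mono_left
    (nhdsWithin_mono 0 fun x (hx : x ∈ Set.Ioi 0) => (Set.mem_Ioi.1 hx).ne')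
  simpa using h

lemma gaussian_shift_le {V y ε : ℝ} (hV : 0 < V) (h0 : 0 < ε) (h1 : ε < 1) :
    Real.exp (-(y - ε) ^ 2 / (2 * V)) ≤
      Real.exp (1 / (2 * V)) * Real.exp (-(1 / (4 * V)) * y ^ 2) := by
  rw [← Real.exp_add, Real.exp_le_exp]
  have h : 1 / (2 * V) + -(1 / (4 * V)) * y ^ 2 = (1 - y ^ 2 / 2) / (2 * V) := by
    field_simp
    ring
  rw [h]
  gcongr
  nlinarith [sq_nonneg (y - 2 * ε)]

lemma abs_inv_mul_one_sub_exp_le {y c ε : ℝ} (hy : 0 < y) (hc : 0 < c) (hε : 0 < ε) :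
    |ε⁻¹ * (1 - Real.exp (-(2 * y * ε) / c))| ≤ 2 / c * y := by
  have hexp : Real.exp (-(2 * y * ε) / c) ≤ 1 := by
    rw [Real.exp_le_one_iff, neg_div]
    exact neg_nonpos.2 (by positivity)
  rw [abs_of_nonneg (mul_nonneg (by positivity) (sub_nonneg.2 hexp)), inv_mul_le_iff₀ hε]
  have h := Real.add_one_le_exp (-(2 * y * ε) / c)
  have h' : -(2 * y * ε) / c = -(ε * (2 / c * y)) := by ring
  linarith

/-- First-order behaviour as `ε → 0+` of a shifted Gaussian moment weighted by
`1 - exp (-(2 y ε) / c)`. -/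
lemma tendsto_inv_mul_integral {V c s : ℝ} (hV : 0 < V) (hc : 0 < c) (hs : -2 < s) :
    Tendsto
      (fun ε : ℝ => ε⁻¹ * ∫ y in Set.Ioi (0 : ℝ),
        y ^ s * Real.exp (-(y - ε) ^ 2 / (2 * V)) * (1 - Real.exp (-(2 * y * ε) / c)))
      (𝓝[>] 0)
      (𝓝 (2 / c * ∫ y in Set.Ioi (0 : ℝ), y ^ (s + 1) * Real.exp (-y ^ 2 / (2 * V)))) := by
  simp_rw [← integral_const_mul]
  refine tendsto_integral_filter_of_dominated_convergence
    (fun y => 2 / c * Real.exp (1 / (2 * V)) *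
      (y ^ (s + 1) * Real.exp (-(1 / (4 * V)) * y ^ 2))) ?_ ?_ ?_ ?_
  · refine Eventually.of_forall fun ε => Measurable.aestronglyMeasurable ?_
    fun_prop
  · filter_upwards [Ioo_mem_nhdsGT (zero_lt_one (α := ℝ))] with ε hε
    filter_upwards [ae_restrict_mem measurableSet_Ioi] with y (hy : 0 < y)
    calc ‖ε⁻¹ * (y ^ s * Real.exp (-(y - ε) ^ 2 / (2 * V)) * (1 - Real.exp (-(2 * y * ε) / c)))‖
        = y ^ s * Real.exp (-(y - ε) ^ 2 / (2 * V)) *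
            |ε⁻¹ * (1 - Real.exp (-(2 * y * ε) / c))| := by
          rw [mul_left_comm, norm_mul, Real.norm_of_nonneg (by positivity), Real.norm_eq_abs]
      _ ≤ y ^ s * (Real.exp (1 / (2 * V)) * Real.exp (-(1 / (4 * V)) * y ^ 2)) *
            (2 / c * y) := by
          gcongr
          · exact gaussian_shift_le hV hε.1 hε.2
          · exact abs_inv_mul_one_sub_exp_le hy hc hε.1
      _ = _ := by
          rw [Real.rpow_add_one hy.ne']
          ring
  · exact (integrableOn_rpow_mul_exp_neg_mul_sq (by positivity) (by linarith)).const_mul _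
  · filter_upwards [ae_restrict_mem measurableSet_Ioi] with y (hy : 0 < y)
    have hexp : Tendsto (fun ε : ℝ => y ^ s * Real.exp (-(y - ε) ^ 2 / (2 * V))) (𝓝[>] 0)
        (𝓝 (y ^ s * Real.exp (-y ^ 2 / (2 * V)))) := by
      have h : Continuous fun ε : ℝ => y ^ s * Real.exp (-(y - ε) ^ 2 / (2 * V)) := by fun_prop
      simpa using (h.tendsto 0).mono_left nhdsWithin_le_nhds
    convert hexp.mul (tendsto_inv_mul_one_sub_exp y c) using 2
    · ring
    · rw [Real.rpow_add_one hy.ne']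
      ring

lemma integral_mul_exp_neg_sq_div_pos {V : ℝ} (hV : 0 < V) :
    0 < ∫ y in Set.Ioi (0 : ℝ), y * Real.exp (-y ^ 2 / (2 * V)) := by
  have h := integral_rpow_mul_exp_neg_mul_rpow (p := 2) (q := 1) (b := 1 / (2 * V))
    (by norm_num) (by norm_num) (by positivity)
  have hcongr : ∀ y : ℝ, y ^ (1 : ℝ) * Real.exp (-(1 / (2 * V)) * y ^ (2 : ℝ)) =
      y * Real.exp (-y ^ 2 / (2 * V)) := fun y => by
    rw [Real.rpow_one, Real.rpow_two]
    ring_nf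
  simp_rw [hcongr] at h
  rw [h]
  have := Real.Gamma_pos_of_pos (s := (1 + 1) / 2) (by norm_num)
  positivity

/-- For `0 < δ < T`, as `ε → 0+`, the ratio
`(∫_0^∞ y^{-3/2} e^{-(y−ε)²/(2(T−δ))}(1−e^{-2yε/δ}) dy) /
 (∫_0^∞ e^{-(y−ε)²/(2T)}(1−e^{-2yε/T}) dy)` converges to
`(T/δ) (∫_0^∞ y^{-1/2} e^{-y²/(2(T−δ))} dy) / (∫_0^∞ y e^{-y²/(2T)} dy)`. -/
theorem ratio_limit (T δ : ℝ) (hδ : 0 < δ) (hδT : δ < T) :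
    Tendsto
      (fun ε : ℝ =>
        (∫ y in Set.Ioi (0 : ℝ),
            y ^ (-(3 : ℝ) / 2) * Real.exp (-(y - ε) ^ 2 / (2 * (T - δ))) *
              (1 - Real.exp (-(2 * y * ε) / δ))) /
          (∫ y in Set.Ioi (0 : ℝ),
            Real.exp (-(y - ε) ^ 2 / (2 * T)) * (1 - Real.exp (-(2 * y * ε) / T))))
      (𝓝[>] 0)
      (𝓝 ((T / δ) *
        (∫ y in Set.Ioi (0 : ℝ), y ^ (-(1 : ℝ) / 2) * Real.exp (-y ^ 2 / (2 * (T - δ)))) /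
          (∫ y in Set.Ioi (0 : ℝ), y * Real.exp (-y ^ 2 / (2 * T))))) := by
  have hT : 0 < T := hδ.trans hδT
  have hnum := tendsto_inv_mul_integral (s := -(3 : ℝ) / 2) (sub_pos.2 hδT) hδ (by norm_num)
  have hden := tendsto_inv_mul_integral (s := 0) hT hT (by norm_num)
  simp only [Real.rpow_zero, one_mul, zero_add, Real.rpow_one] at hden
  rw [show -(3 : ℝ) / 2 + 1 = -(1 : ℝ) / 2 by norm_num] at hnum
  have hpos := integral_mul_exp_neg_sq_div_pos hT
  have h := hnum.div hden (by positivity)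
  refine (h.congr' ?_).trans_eq ?_
  · filter_upwards [self_mem_nhdsWithin] with ε (hε : 0 < ε)
    exact mul_div_mul_left _ _ (inv_ne_zero hε.ne')
  · congr 1
    field_simp
end

section
/- Let T > 0, d ≥ 1, and let b : [0,T) × ℝ^d → ℝ^d satisfy the monotonicity (one-sided dissipativity) condition ⟨ b(t,x) − b(t,y), x − y ⟩ ≤ 0 for all t ∈ [0,T) and x,y ∈ ℝ^d. Suppose Y, Ỹ : [0,T] → ℝ^d are continuous, the functions s ↦ b(s,Y(s)) and s ↦ b(s,Ỹ(s)) are integrable on [0,t] for every t < T, Y(0) = Ỹ(0), and for all t ∈ [0,T): Y(t) − ∫_0^t b(s,Y(s)) ds = Ỹ(t) − ∫_0^t b(s,Ỹ(s)) ds. Then Y(t) = Ỹ(t) for all t ∈ [0,T]. -/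
open MeasureTheory intervalIntegral

/-- The square of the primitive of an integrable function `g` is the integral of `2 g G`. -/
theorem sq_integral_eq_integral_mul_primitive {g : ℝ → ℝ} {a c : ℝ}
    (hg : IntervalIntegrable g volume a c) :
    (∫ x in a..c, g x) ^ 2 = ∫ x in a..c, 2 * (g x * ∫ s in a..x, g s) := by
  have hac := hg.absolutelyContinuousOnInterval_intervalIntegral Set.left_mem_uIcc
  have key := hac.integral_deriv_mul_eq_sub hac
  simp only [integral_same, mul_zero, sub_zero] at key
  rw [sq, ← key]
  refine integral_congr_ae ?_
  filter_upwards [hg.ae_hasDerivAt_integral] with x hx hxm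
  rw [(hx (Set.uIoc_subset_uIcc hxm) a Set.left_mem_uIcc).deriv]
  ring

/-- The squared norm of the primitive of an integrable vector-valued function `g` is the integral
of `2 ⟪g, G⟫`. -/
theorem norm_sq_integral_eq_integral_inner_primitive {ι : Type*} [Fintype ι]
    {g : ℝ → EuclideanSpace ℝ ι} {a c : ℝ} (hg : IntervalIntegrable g volume a c) :
    ‖∫ x in a..c, g x‖ ^ 2 =
      ∫ x in a..c, 2 * inner (𝕜 := ℝ) (g x) (∫ s in a..x, g s) := by
  have hgi (i : ι) : IntervalIntegrable (fun x => g x i) volume a c :=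
    ⟨(EuclideanSpace.proj (𝕜 := ℝ) i).integrable_comp hg.1,
      (EuclideanSpace.proj (𝕜 := ℝ) i).integrable_comp hg.2⟩
  have happly (i : ι) {x : ℝ} (hx : x ∈ Set.uIcc a c) :
      (∫ s in a..x, g s) i = ∫ s in a..x, g s i :=
    ((EuclideanSpace.proj (𝕜 := ℝ) i).intervalIntegral_comp_comm
      (hg.mono_set (Set.uIcc_subset_uIcc_left hx))).symm
  have hint (i : ι) :
      IntervalIntegrable (fun x => 2 * (g x i * ∫ s in a..x, g s i)) volume a c :=
    ((hgi i).mul_continuousOn ((hgi i).absolutelyContinuousOnInterval_intervalIntegral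
      Set.left_mem_uIcc).continuousOn).const_mul 2
  rw [EuclideanSpace.real_norm_sq_eq]
  simp_rw [happly _ Set.right_mem_uIcc, fun i => sq_integral_eq_integral_mul_primitive (hgi i)]
  rw [← integral_finsetSum fun i _ => hint i]
  refine integral_congr fun x hx => ?_
  simp only [PiLp.inner_apply, happly _ hx, Finset.mul_sum, RCLike.inner_apply, conj_trivial]
  exact Finset.sum_congr rfl fun i _ => by ring

/-- Deterministic core of pathwise uniqueness: if `b(t,·)` is one-sidedly dissipative
(`⟨b(t,x) − b(t,y), x − y⟩ ≤ 0`), two continuous paths with the same initial value and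
the same "noise" `Y(t) − ∫_0^t b(s,Y(s)) ds` coincide on `[0,T]`. -/
theorem pathwise_uniqueness_dissipative (T : ℝ) (hT : 0 < T) (d : ℕ) (hd : 1 ≤ d)
    (b : ℝ → EuclideanSpace ℝ (Fin d) → EuclideanSpace ℝ (Fin d))
    (hb : ∀ t ∈ Set.Ico (0 : ℝ) T, ∀ x y : EuclideanSpace ℝ (Fin d),
      inner (𝕜 := ℝ) (b t x - b t y) (x - y) ≤ 0)
    (Y Z : ℝ → EuclideanSpace ℝ (Fin d))
    (hYc : ContinuousOn Y (Set.Icc 0 T)) (hZc : ContinuousOn Z (Set.Icc 0 T))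
    (hYint : ∀ t : ℝ, t < T → IntervalIntegrable (fun s => b s (Y s)) volume 0 t)
    (hZint : ∀ t : ℝ, t < T → IntervalIntegrable (fun s => b s (Z s)) volume 0 t)
    (h0 : Y 0 = Z 0)
    (hnoise : ∀ t ∈ Set.Ico (0 : ℝ) T,
      Y t - ∫ s in (0 : ℝ)..t, b s (Y s) = Z t - ∫ s in (0 : ℝ)..t, b s (Z s)) :
    ∀ t ∈ Set.Icc (0 : ℝ) T, Y t = Z t := by
  have hdiff : ∀ t ∈ Set.Ico (0 : ℝ) T,
      Y t - Z t = ∫ s in (0 : ℝ)..t, (b s (Y s) - b s (Z s)) := fun t ht => by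
    rw [integral_sub (hYint t ht.2) (hZint t ht.2)]
    exact sub_eq_sub_iff_sub_eq_sub.mp (hnoise t ht)
  have heq : Set.EqOn Y Z (Set.Ico 0 T) := fun t ht => by
    have hsq := norm_sq_integral_eq_integral_inner_primitive
      ((hYint t ht.2).sub (hZint t ht.2))
    have hle : ∫ x in (0 : ℝ)..t, 2 * inner (𝕜 := ℝ) (b x (Y x) - b x (Z x))
        (∫ s in (0 : ℝ)..x, (b s (Y s) - b s (Z s))) ≤ 0 := by
      rw [← neg_nonneg, ← intervalIntegral.integral_neg]
      refine intervalIntegral.integral_nonneg ht.1 fun x hx => ?_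
      have hxT : x ∈ Set.Ico 0 T := ⟨hx.1, hx.2.trans_lt ht.2⟩
      rw [← hdiff x hxT]
      linarith [hb x hxT (Y x) (Z x)]
    rw [← hsq, ← hdiff t ht] at hle
    exact sub_eq_zero.mp (norm_eq_zero.mp (pow_eq_zero_iff two_ne_zero |>.mp
      (le_antisymm hle (sq_nonneg _))))
  exact heq.of_subset_closure hYc hZc Set.Ico_subset_Icc_self (closure_Ico hT.ne).ge
end
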